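/- There exist constants c > 0, C > 0 and a threshold D such that for every integer d ≥ D, letting τ_d := max{Im z : z ∈ ℂ, L_d(z) = 0} be the largest imaginary part of a root of L_d, one has c·d^{1/3} ≤ d - τ_d ≤ C·d^{1/3}. -/

import Mathlib

/-- `binom(y, d) = (∏_{k=0}^{d-1} (y - k)) / d!` for complex `y`. -/
noncomputable def cbinom (y : ℂ) (d : ℕ) : ℂ :=
  (∏ k ∈ Finset.range d, (y - k)) / (Nat.factorial d : ℂ)

/-- The Ehrhart polynomial of the `d`-dimensional cross-polytope. -/
noncomputable def Lpoly (d : ℕ) (x : ℂ) : ℂ :=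
  ∑ j ∈ Finset.range (d + 1), (Nat.choose d j : ℂ) * cbinom ((d : ℂ) - (j : ℂ) + x) d

open Finset in
theorem cbinom_succ_sub (y : ℂ) (d : ℕ) :
    cbinom y (d + 1) - cbinom (y - 1) (d + 1) = cbinom (y - 1) d := by
  have h1 : ∏ k ∈ range (d + 1), (y - k) = (∏ k ∈ range d, (y - 1 - k)) * y := by
    rw [prod_range_succ']
    congr 1
    · refine prod_congr rfl fun k _ => ?_
      push_cast
      ring
    · simp
  have hd : (d.factorial : ℂ) ≠ 0 := by exact_mod_cast d.factorial_ne_zero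
  have hd1 : (d : ℂ) + 1 ≠ 0 := by exact_mod_cast d.succ_ne_zero
  unfold cbinom
  rw [h1, prod_range_succ, Nat.factorial_succ]
  push_cast
  field_simp
  ring

theorem cbinom_zero_right (y : ℂ) : cbinom y 0 = 1 := by simp [cbinom]

theorem cbinom_natCast_of_lt {m d : ℕ} (h : m < d) : cbinom m d = 0 := by
  unfold cbinom
  rw [Finset.prod_eq_zero (Finset.mem_range.2 h) (sub_self _), zero_div]

theorem cbinom_self (d : ℕ) : cbinom d d = 1 := by
  induction d with
  | zero => exact cbinom_zero_right _
  | succ d ih =>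
    have h := cbinom_succ_sub ((d + 1 : ℕ) : ℂ) d
    have e : ((d + 1 : ℕ) : ℂ) - 1 = (d : ℕ) := by push_cast; ring
    rw [e, cbinom_natCast_of_lt (Nat.lt_succ_self d), ih] at h
    simpa using h

theorem Lpoly_zero_left (x : ℂ) : Lpoly 0 x = 1 := by
  simp [Lpoly, cbinom_zero_right]

theorem Lpoly_one_left (x : ℂ) : Lpoly 1 x = 2 * x + 1 := by
  simp [Lpoly, cbinom, Finset.sum_range_succ]
  ring

theorem Lpoly_zero_right (d : ℕ) : Lpoly d 0 = 1 := by
  unfold Lpoly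
  rw [Finset.sum_range_succ', Finset.sum_eq_zero]
  · simp [cbinom_self]
  · intro j hj
    have hj' := Finset.mem_range.1 hj
    have e : (d : ℂ) - ((j + 1 : ℕ) : ℂ) + 0 = ((d - (j + 1) : ℕ) : ℂ) := by
      rw [Nat.cast_sub hj', add_zero]
    rw [e, cbinom_natCast_of_lt (by omega), mul_zero]

open Finset in
/-- The Delannoy-type recurrence satisfied by `Lpoly`. -/
theorem Lpoly_succ_sub (d : ℕ) (x : ℂ) :
    Lpoly (d + 1) x - Lpoly (d + 1) (x - 1) = Lpoly d x + Lpoly d (x - 1) := by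
  have h1 : Lpoly (d + 1) x - Lpoly (d + 1) (x - 1)
      = ∑ j ∈ range (d + 2), ((d + 1).choose j : ℂ) * cbinom ((d : ℂ) - j + x) d := by
    unfold Lpoly
    rw [← sum_sub_distrib]
    refine sum_congr rfl fun j _ => ?_
    have h := cbinom_succ_sub (((d + 1 : ℕ) : ℂ) - j + x) d
    have e1 : ((d + 1 : ℕ) : ℂ) - j + (x - 1) = ((d + 1 : ℕ) : ℂ) - j + x - 1 := by ring
    have e2 : ((d + 1 : ℕ) : ℂ) - j + x - 1 = (d : ℂ) - j + x := by push_cast; ring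
    rw [← mul_sub, e1, h, e2]
  have h2 : ∑ j ∈ range (d + 1), (d.choose (j + 1) : ℂ) * cbinom ((d : ℂ) - (j + 1 : ℕ) + x) d
      + cbinom ((d : ℂ) - (0 : ℕ) + x) d = Lpoly d x := by
    have h := sum_range_succ' (fun j : ℕ => (d.choose j : ℂ) * cbinom ((d : ℂ) - j + x) d) (d + 1)
    rw [sum_range_succ] at h
    simp only [Nat.choose_succ_self, Nat.choose_zero_right, Nat.cast_zero, zero_mul, add_zero,
      Nat.cast_one, one_mul] at h
    rw [Lpoly, h, Nat.cast_zero]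
  have h3 : ∑ j ∈ range (d + 1), (d.choose j : ℂ) * cbinom ((d : ℂ) - (j + 1 : ℕ) + x) d
      = Lpoly d (x - 1) := by
    refine sum_congr rfl fun j _ => ?_
    congr 2
    push_cast
    ring
  rw [h1, sum_range_succ', ← h2, ← h3]
  simp only [Nat.choose_succ_succ, Nat.cast_add, add_mul, sum_add_distrib, Nat.choose_zero_right,
    Nat.cast_one, one_mul, Nat.cast_zero]
  ring

theorem Lpoly_recurrence_natCast (d m : ℕ) :
    ((d : ℂ) + 2) * Lpoly (d + 2) m
      = (2 * (m : ℂ) + 1) * Lpoly (d + 1) m + ((d : ℂ) + 1) * Lpoly d m := by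
  induction d generalizing m with
  | zero =>
    induction m with
    | zero => simp [Lpoly_zero_right]; norm_num
    | succ m ihm =>
      have h2 := Lpoly_succ_sub 1 ((m + 1 : ℕ) : ℂ)
      have e : ((m + 1 : ℕ) : ℂ) - 1 = (m : ℂ) := by push_cast; ring
      rw [e] at h2
      simp only [zero_add, Lpoly_zero_left, Lpoly_one_left, Nat.cast_zero] at *
      push_cast at *
      linear_combination ihm + 2 * h2
  | succ d ih =>
    induction m with
    | zero => simp [Lpoly_zero_right]; ring
    | succ m ihm =>
      have e : ((m + 1 : ℕ) : ℂ) - 1 = (m : ℂ) := by push_cast; ring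
      have h2 := Lpoly_succ_sub (d + 2) ((m + 1 : ℕ) : ℂ)
      have h1 := Lpoly_succ_sub (d + 1) ((m + 1 : ℕ) : ℂ)
      have h0 := Lpoly_succ_sub d ((m + 1 : ℕ) : ℂ)
      have r1 := ih (m + 1)
      have r0 := ih m
      rw [e] at h0 h1 h2
      push_cast at *
      simp only [show d + 1 + 2 = d + 2 + 1 from rfl, show d + 1 + 1 = d + 2 from rfl] at *
      linear_combination ihm + ((d : ℂ) + 3) * h2 - 2 * ((m : ℂ) + 1) * h1
        - ((d : ℂ) + 1) * h0 + r1 + r0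

theorem exists_polynomial_eval_eq_Lpoly (d : ℕ) :
    ∃ p : Polynomial ℂ, ∀ x, p.eval x = Lpoly d x := by
  refine ⟨∑ j ∈ Finset.range (d + 1), Polynomial.C (d.choose j : ℂ) *
    ((∏ k ∈ Finset.range d, (Polynomial.C ((d : ℂ) - j - k) + Polynomial.X)) *
      Polynomial.C ((d.factorial : ℂ)⁻¹)), fun x => ?_⟩
  simp only [Lpoly, cbinom, Polynomial.eval_finsetSum, Polynomial.eval_mul, Polynomial.eval_C,
    Polynomial.eval_prod, Polynomial.eval_add, Polynomial.eval_X, div_eq_mul_inv]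
  refine Finset.sum_congr rfl fun j _ => ?_
  congr 2
  refine Finset.prod_congr rfl fun k _ => ?_
  ring

/-- The three-term recurrence of the Ehrhart polynomials of cross-polytopes. -/
theorem Lpoly_recurrence (d : ℕ) (x : ℂ) :
    ((d : ℂ) + 2) * Lpoly (d + 2) x
      = (2 * x + 1) * Lpoly (d + 1) x + ((d : ℂ) + 1) * Lpoly d x := by
  obtain ⟨p0, h0⟩ := exists_polynomial_eval_eq_Lpoly d
  obtain ⟨p1, h1⟩ := exists_polynomial_eval_eq_Lpoly (d + 1)
  obtain ⟨p2, h2⟩ := exists_polynomial_eval_eq_Lpoly (d + 2)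
  have h : Polynomial.C ((d : ℂ) + 2) * p2
      = (2 * Polynomial.X + 1) * p1 + Polynomial.C ((d : ℂ) + 1) * p0 := by
    refine Polynomial.eq_of_infinite_eval_eq _ _
      ((Set.infinite_range_of_injective (Nat.cast_injective (R := ℂ))).mono ?_)
    rintro _ ⟨m, rfl⟩
    simpa [h0, h1, h2] using Lpoly_recurrence_natCast d m
  simpa [h0, h1, h2] using congrArg (Polynomial.eval x) h

theorem Lpoly_recurrence' (n : ℕ) (x : ℂ) :
    (2 * x + 1) * Lpoly n x = ((n : ℂ) + 1) * Lpoly (n + 1) x - (n : ℂ) * Lpoly (n - 1) x := by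
  cases n with
  | zero => simp [Lpoly_zero_left, Lpoly_one_left]
  | succ n =>
    have h := Lpoly_recurrence n x
    push_cast
    simp only [show n + 1 + 1 = n + 2 from rfl]
    linear_combination -h

/-- A weighted Gershgorin bound for the Jacobi matrix with off-diagonal entries `1, 2, …`. -/
theorem le_of_supersolution {d : ℕ} (hd : 0 < d) {u v : ℕ → ℝ} {a b : ℝ}
    (hv0 : 0 < v 0) (hvd : v d = 0) (hu : ∀ n < d, 0 < u n) (hud : 0 ≤ u d)
    (hva : ∀ n < d, a * v n ≤ ((n : ℝ) + 1) * v (n + 1) + n * v (n - 1))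
    (hub : ∀ n < d, ((n : ℝ) + 1) * u (n + 1) + n * u (n - 1) ≤ b * u n) : a ≤ b := by
  obtain ⟨m, hm, hmax⟩ := Finset.exists_max_image (Finset.range d) (fun n => v n / u n)
    ⟨0, Finset.mem_range.2 hd⟩
  rw [Finset.mem_range] at hm
  set M := v m / u m with hM
  have hMpos : 0 < M :=
    (div_pos hv0 (hu 0 hd)).trans_le (hmax 0 (Finset.mem_range.2 hd))
  have hle : ∀ n ≤ d, v n ≤ M * u n := by
    intro n hn
    rcases hn.lt_or_eq with h | rfl
    · exact (div_le_iff₀ (hu n h)).1 (hmax n (Finset.mem_range.2 h))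
    · rw [hvd]
      positivity
  have hvm : v m = M * u m := (div_mul_cancel₀ _ (hu m hm).ne').symm
  have hvpos : 0 < v m := hvm ▸ mul_pos hMpos (hu m hm)
  refine le_of_mul_le_mul_right ?_ hvpos
  calc a * v m ≤ ((m : ℝ) + 1) * v (m + 1) + m * v (m - 1) := hva m hm
    _ ≤ ((m : ℝ) + 1) * (M * u (m + 1)) + m * (M * u (m - 1)) := by
      gcongr
      · exact hle _ hm
      · exact hle _ (by omega)
    _ = M * (((m : ℝ) + 1) * u (m + 1) + m * u (m - 1)) := by ring
    _ ≤ M * (b * u m) := by gcongr; exact hub m hm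
    _ = b * v m := by rw [hvm]; ring

theorem im_le_of_supersolution {d : ℕ} (hd : 0 < d) {u : ℕ → ℝ} {l : ℝ}
    (hu : ∀ n < d, 0 < u n) (hud : 0 ≤ u d)
    (hub : ∀ n < d, ((n : ℝ) + 1) * u (n + 1) + n * u (n - 1) ≤ 2 * l * u n)
    {z : ℂ} (hz : Lpoly d z = 0) : z.im ≤ l := by
  have h : ‖2 * z + 1‖ ≤ 2 * l := by
    refine le_of_supersolution hd (v := fun n => ‖Lpoly n z‖) ?_ ?_ hu hud ?_ hub
    · simp [Lpoly_zero_left]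
    · simp [hz]
    · intro n _
      have hn : ‖(n : ℂ) + 1‖ = (n : ℝ) + 1 := by
        exact_mod_cast Complex.norm_natCast (n + 1)
      calc ‖2 * z + 1‖ * ‖Lpoly n z‖ = ‖(2 * z + 1) * Lpoly n z‖ := (norm_mul _ _).symm
        _ ≤ ‖((n : ℂ) + 1) * Lpoly (n + 1) z‖ + ‖(n : ℂ) * Lpoly (n - 1) z‖ := by
          rw [Lpoly_recurrence']
          exact norm_sub_le _ _
        _ = _ := by rw [norm_mul, norm_mul, hn, Complex.norm_natCast]
  have h2 : (2 * z + 1).im ≤ ‖2 * z + 1‖ := (le_abs_self _).trans (Complex.abs_im_le_norm _)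
  simp at h2
  linarith

/-- The explicit supersolution: constant up to `d - W`, then a concave parabola. -/
theorem im_le_of_Lpoly_eq_zero {d W : ℕ} {δ : ℝ} (hW : 0 < W) (hWd : W ≤ d)
    (h1 : δ ≤ W - 1) (h2 : δ * (2 * (W : ℝ) ^ 2) ≤ d) {z : ℂ} (hz : Lpoly d z = 0) :
    z.im ≤ d - δ := by
  have hW' : (0 : ℝ) < W := by exact_mod_cast hW
  have hpos : ∀ n ≤ d, (0 : ℝ) < 2 * (W : ℝ) ^ 2 - ((n + W - d : ℕ) : ℝ) ^ 2 := by
    intro n hn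
    have h : ((n + W - d : ℕ) : ℝ) ≤ W := by exact_mod_cast (by omega)
    have h0 : (0 : ℝ) ≤ ((n + W - d : ℕ) : ℝ) := Nat.cast_nonneg _
    nlinarith
  refine im_le_of_supersolution (by omega)
    (u := fun n => 2 * (W : ℝ) ^ 2 - ((n + W - d : ℕ) : ℝ) ^ 2)
    (fun n hn => hpos n hn.le) (hpos d le_rfl).le ?_ hz
  intro n hn
  have hnd : (n : ℝ) + 1 ≤ d := by exact_mod_cast hn
  rcases Nat.lt_or_ge d (n + W) with hk | hk
  · obtain ⟨k, hk⟩ : ∃ k, n + W = d + (k + 1) := ⟨n + W - d - 1, by omega⟩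
    have hp := hpos n hn.le
    have hkW : k + 1 < W := by omega
    have e0 : n + W - d = k + 1 := by omega
    have e1 : n + 1 + W - d = k + 2 := by omega
    have e2 : n - 1 + W - d = k := by omega
    have hkW' : (k : ℝ) + 1 < W := by exact_mod_cast hkW
    have hk0 : (0 : ℝ) ≤ k := Nat.cast_nonneg k
    have hn0 : (0 : ℝ) ≤ n := Nat.cast_nonneg n
    simp only [e0, e1, e2] at hp ⊢
    push_cast at hp ⊢
    set U : ℝ := 2 * (W : ℝ) ^ 2 - ((k : ℝ) + 1) ^ 2 with hU
    have hU1 : 1 ≤ U := by nlinarith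
    have hδ : δ * U ≤ d := by
      rcases le_or_gt δ 0 with h | h
      · nlinarith
      · refine le_trans ?_ h2
        gcongr
        nlinarith
    have a1 : 2 * (W : ℝ) ^ 2 - ((k : ℝ) + 2) ^ 2 = U - 2 * (k + 1) - 1 := by rw [hU]; ring
    have a2 : 2 * (W : ℝ) ^ 2 - (k : ℝ) ^ 2 = U + 2 * (k + 1) - 1 := by rw [hU]; ring
    rw [a1, a2]
    nlinarith [mul_le_mul_of_nonneg_right hnd (sub_nonneg.2 hU1)]
  · have hk' : (n : ℝ) + W ≤ d := by exact_mod_cast hk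
    have e0 : n + W - d = 0 := by omega
    have e2 : n - 1 + W - d = 0 := by omega
    have hn0 : (0 : ℝ) ≤ n := Nat.cast_nonneg n
    simp only [e0, e2]
    have hs : 0 ≤ (((n + 1 + W - d : ℕ) : ℝ)) ^ 2 := sq_nonneg _
    have hW2 : 0 < (W : ℝ) ^ 2 := by positivity
    push_cast
    nlinarith [mul_nonneg (add_nonneg hn0 zero_le_one) hs,
      mul_nonneg hW2.le (show (0 : ℝ) ≤ d - δ - n - 1 / 2 by linarith)]

/-- The real orthogonal polynomials `(-i)ⁿ L_n(-1/2 + i t)`. -/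
noncomputable def Lreal (t : ℝ) : ℕ → ℝ
  | 0 => 1
  | 1 => 2 * t
  | n + 2 => (2 * t * Lreal t (n + 1) - ((n : ℝ) + 1) * Lreal t n) / ((n : ℝ) + 2)

theorem Lreal_recurrence (t : ℝ) (n : ℕ) :
    ((n : ℝ) + 1) * Lreal t (n + 1) + n * Lreal t (n - 1) = 2 * t * Lreal t n := by
  cases n with
  | zero => simp [Lreal]
  | succ n =>
    simp only [Nat.add_sub_cancel, Lreal]
    push_cast
    field_simp
    ring

theorem Lpoly_eq_Lreal (t : ℝ) (n : ℕ) :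
    Lpoly n (-1 / 2 + t * Complex.I) = Complex.I ^ n * Lreal t n := by
  induction n using Nat.twoStepInduction with
  | zero => simp [Lpoly_zero_left, Lreal]
  | one =>
    rw [Lpoly_one_left]
    simp [Lreal]
    ring
  | more n h0 h1 =>
    have h := Lpoly_recurrence n (-1 / 2 + t * Complex.I)
    have hn : (n : ℂ) + 2 ≠ 0 := by exact_mod_cast (n + 1).succ_ne_zero
    refine mul_left_cancel₀ hn ?_
    rw [h, h0, h1, Lreal]
    push_cast
    field_simp
    have hI : Complex.I ^ 2 = -1 := Complex.I_sq
    simp only [pow_add, pow_one, hI]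
    linear_combination (2 * (t : ℂ) * Complex.I ^ n * Lreal t (n + 1)) * hI

theorem continuous_Lreal (n : ℕ) : Continuous fun t => Lreal t n := by
  induction n using Nat.twoStepInduction with
  | zero => simpa only [Lreal] using continuous_const
  | one => simp only [Lreal]; fun_prop
  | more n h0 h1 => simp only [Lreal]; fun_prop

theorem Lreal_pos {d : ℕ} {t : ℝ} (ht : (d : ℝ) ≤ t) {n : ℕ} (hn : n ≤ d) : 0 < Lreal t n := by
  have key : ∀ n, n + 1 ≤ d → 0 < Lreal t n ∧ Lreal t n ≤ Lreal t (n + 1) := by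
    intro n
    induction n with
    | zero =>
      intro h
      have h' : (1 : ℝ) ≤ d := by exact_mod_cast h
      simp only [Lreal]
      exact ⟨one_pos, by linarith⟩
    | succ n ih =>
      intro h
      obtain ⟨h1, h2⟩ := ih (by omega)
      have h3 : 0 < Lreal t (n + 1) := h1.trans_le h2
      have h' : (n : ℝ) + 2 ≤ d := by exact_mod_cast h
      refine ⟨h3, ?_⟩
      have hr := Lreal_recurrence t (n + 1)
      push_cast at hr
      have hn0 : (0 : ℝ) ≤ n := Nat.cast_nonneg n
      have e : ((n : ℝ) + 2) * Lreal t (n + 1) ≤ ((n : ℝ) + 2) * Lreal t (n + 1 + 1) := by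
        nlinarith [mul_le_mul_of_nonneg_left h2 (by positivity : (0 : ℝ) ≤ n + 1),
          mul_nonneg h3.le (show (0 : ℝ) ≤ t - (n + 2) by linarith)]
      exact le_of_mul_le_mul_left e (by positivity)
  cases n with
  | zero => simp [Lreal]
  | succ n => exact (key n hn).1.trans_le (key n hn).2

/-- A Sturm-type argument: if some `Lreal t n` with `n ≤ d` fails to be positive, then
`Lreal · d` has a zero at or beyond `t`. -/
theorem exists_ge_Lreal_eq_zero {d : ℕ} {t : ℝ} (h : ∃ n ≤ d, Lreal t n ≤ 0) :
    ∃ s, t ≤ s ∧ Lreal s d = 0 := by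
  set S : Set ℝ := ⋃ n ∈ Set.Iic d, {s | Lreal s n ≤ 0} with hS
  have mem_S : ∀ s, s ∈ S ↔ ∃ n ≤ d, Lreal s n ≤ 0 := by simp [hS]
  have hclosed : IsClosed S := (Set.finite_Iic d).isClosed_biUnion fun n _ =>
    isClosed_le (continuous_Lreal n) continuous_const
  have hbdd : BddAbove S := by
    refine ⟨d, fun s hs => ?_⟩
    obtain ⟨n, hn, hle⟩ := (mem_S s).1 hs
    by_contra! hlt
    exact absurd (Lreal_pos hlt.le hn) hle.not_gt
  have htS : t ∈ S := (mem_S t).2 h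
  have hsS : sSup S ∈ S := hclosed.csSup_mem ⟨t, htS⟩ hbdd
  refine ⟨sSup S, le_csSup hbdd htS, ?_⟩
  set s := sSup S
  have hnonneg : ∀ n ≤ d, 0 ≤ Lreal s n := by
    intro n hn
    refine ge_of_tendsto (((continuous_Lreal n).tendsto s).mono_left
      (nhdsWithin_le_nhds (s := Set.Ioi s))) ?_
    filter_upwards [self_mem_nhdsWithin] with r hr
    by_contra! hlt
    exact absurd (le_csSup hbdd ((mem_S r).2 ⟨n, hn, hlt.le⟩)) (not_le.2 hr)
  classical
  have hex := (mem_S s).1 hsS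
  obtain ⟨hn, hle⟩ := Nat.find_spec hex
  have hmin := fun m => Nat.find_min hex (m := m)
  set n := Nat.find hex
  have hzero : Lreal s n = 0 := le_antisymm hle (hnonneg n hn)
  rcases hn.lt_or_eq with hlt | heq
  · exfalso
    have hn0 : n ≠ 0 := by
      intro h0
      rw [h0] at hzero
      simp [Lreal] at hzero
    have hprev : 0 < Lreal s (n - 1) := by
      by_contra! hneg
      exact hmin (n - 1) (by omega) ⟨by omega, hneg⟩
    have hr := Lreal_recurrence s n
    rw [hzero, mul_zero] at hr
    have hnpos : (0 : ℝ) < n := by exact_mod_cast Nat.pos_of_ne_zero hn0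
    have := hnonneg (n + 1) hlt
    nlinarith [mul_pos hnpos hprev, mul_nonneg (add_pos hnpos one_pos).le this]
  · rwa [heq] at hzero

/-- A nonnegative subsolution at `t` forces a nonpositive value of some `Lreal t n`. -/
theorem exists_Lreal_nonpos {d : ℕ} (hd : 0 < d) {v : ℕ → ℝ} {t : ℝ}
    (hvd : v d = 0) (hvd' : 0 < v (d - 1))
    (hv : ∀ n < d, 2 * t * v n ≤ ((n : ℝ) + 1) * v (n + 1) + n * v (n - 1)) :
    ∃ n ≤ d, Lreal t n ≤ 0 := by
  by_contra! hpos
  have hW : ∀ n ≤ d, 0 ≤ (n : ℝ) * (v n * Lreal t (n - 1) - Lreal t n * v (n - 1)) := by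
    intro n
    induction n with
    | zero => simp
    | succ n ih =>
      intro hn
      have h0 := ih (by omega)
      have h1 := mul_le_mul_of_nonneg_right (hv n hn) (hpos n (by omega)).le
      have h2 := congrArg (v n * ·) (Lreal_recurrence t n)
      simp only [Nat.add_sub_cancel] at h2 ⊢
      push_cast
      linarith
  have h := hW d le_rfl
  rw [hvd] at h
  have hd' : (0 : ℝ) < d := by exact_mod_cast hd
  nlinarith [mul_pos hd' (mul_pos (hpos d le_rfl) hvd')]

open Real in
/-- The explicit subsolution is a half-period of a sine supported on `[d - W, d]`. -/
theorem exists_im_ge_Lpoly_eq_zero {d W : ℕ} (hW : 2 ≤ W) (hWd : W ≤ d) :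
    ∃ z : ℂ, Lpoly d z = 0 ∧ ((d : ℝ) - W) * cos (π / W) ≤ z.im := by
  have hW' : (2 : ℝ) ≤ W := by exact_mod_cast hW
  have hWd' : (W : ℝ) ≤ d := by exact_mod_cast hWd
  set v : ℕ → ℝ := fun n => if d ≤ n + W then sin (((d : ℝ) - n) * (π / W)) else 0 with hvdef
  have hsin : ∀ n : ℕ, d ≤ n + W → v n = sin (((d : ℝ) - n) * (π / W)) := fun n h => if_pos h
  have hWpi : (W : ℝ) * (π / W) = π := by field_simp
  have hq : 0 < π / W := by positivity
  have hnonneg : ∀ n ≤ d, 0 ≤ v n := by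
    intro n hn
    by_cases h : d ≤ n + W
    · rw [hsin n h]
      have h1 : (n : ℝ) ≤ d := by exact_mod_cast hn
      have h2 : (d : ℝ) ≤ n + W := by exact_mod_cast h
      refine sin_nonneg_of_nonneg_of_le_pi (mul_nonneg (by linarith) hq.le) ?_
      calc ((d : ℝ) - n) * (π / W) ≤ W * (π / W) := by gcongr; linarith
        _ = π := hWpi
    · simp [hvdef, h]
  have hcos : 0 ≤ cos (π / W) := by
    refine cos_nonneg_of_neg_pi_div_two_le_of_le (by linarith [pi_pos]) ?_
    exact div_le_div_of_nonneg_left pi_pos.le two_pos hW'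
  have hvd : v d = 0 := by rw [hsin d (by omega)]; simp
  have hvd' : 0 < v (d - 1) := by
    rw [hsin (d - 1) (by omega), Nat.cast_sub (by omega)]
    refine sin_pos_of_pos_of_lt_pi ?_ ?_
    · simpa using hq
    · have := div_lt_self pi_pos (by linarith : (1 : ℝ) < W)
      simpa using this
  obtain ⟨s, hs, hz⟩ := exists_ge_Lreal_eq_zero
    (exists_Lreal_nonpos (by omega) (t := ((d : ℝ) - W) * cos (π / W)) hvd hvd' (by
      intro n hn
      have h1 := hnonneg (n + 1) hn
      have h2 := hnonneg (n - 1) (by omega)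
      have h0 := hnonneg n hn.le
      by_cases h : d < n + W
      · have h' : (d : ℝ) ≤ n + W := by exact_mod_cast h.le
        have hn1 : 1 ≤ n := by omega
        have e : v (n + 1) + v (n - 1) = 2 * cos (π / W) * v n := by
          rw [hsin (n + 1) (by omega), hsin (n - 1) (by omega), hsin n h.le, Nat.cast_sub hn1]
          have e1 : ((d : ℝ) - ((n + 1 : ℕ) : ℝ)) * (π / W) = (d - n) * (π / W) - π / W := by
            push_cast; ring
          have e2 : ((d : ℝ) - ((n : ℝ) - ((1 : ℕ) : ℝ))) * (π / W)
              = (d - n) * (π / W) + π / W := by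
            push_cast; ring
          rw [e1, e2, sin_sub, sin_add]
          ring
        have hm := mul_nonneg (mul_nonneg hcos h0) (show (0 : ℝ) ≤ n - (d - W) by linarith)
        have e' := congrArg ((n : ℝ) * ·) e
        nlinarith
      · have hv0 : v n = 0 := by
          by_cases h' : d = n + W
          · rw [hsin n h'.le, h']
            push_cast
            rw [add_sub_cancel_left, hWpi, sin_pi]
          · simp only [hvdef]
            rw [if_neg (by omega)]
        rw [hv0, mul_zero]
        positivity))
  refine ⟨-1 / 2 + s * Complex.I, ?_, ?_⟩
  · rw [Lpoly_eq_Lreal, hz]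
    simp
  · have e : (-1 / 2 + (s : ℂ) * Complex.I).im = s := by
      simp
    rw [e]
    exact hs

/-- If `τ_d` is the largest imaginary part of a root of `L_d`, then
`d - τ_d = Θ(d^{1/3})`. -/
theorem ehrhart_largest_root_gap :
    ∃ c > 0, ∃ C > 0, ∃ D : ℕ, ∀ d : ℕ, D ≤ d →
      c * (d : ℝ) ^ ((1 : ℝ) / 3) ≤ (d : ℝ) - sSup (Complex.im '' {z : ℂ | Lpoly d z = 0}) ∧
      (d : ℝ) - sSup (Complex.im '' {z : ℂ | Lpoly d z = 0}) ≤ C * (d : ℝ) ^ ((1 : ℝ) / 3) := by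
  refine ⟨1 / 8, by norm_num, 7, by norm_num, 8, fun d hd => ?_⟩
  have hd' : (8 : ℝ) ≤ d := by exact_mod_cast hd
  set x : ℝ := (d : ℝ) ^ ((1 : ℝ) / 3) with hx
  have hx0 : 0 ≤ x := by positivity
  have hx3 : x ^ 3 = d := by
    rw [hx, ← Real.rpow_natCast, ← Real.rpow_mul (by positivity)]
    norm_num
  have hx2 : 2 ≤ x := by
    by_contra! h
    nlinarith [pow_lt_pow_left₀ h hx0 (n := 3) (by norm_num)]
  set W : ℕ := ⌈x⌉₊ with hWdef
  have hxW : x ≤ W := Nat.le_ceil x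
  have hWx : (W : ℝ) ≤ 2 * x := by linarith [Nat.ceil_lt_add_one hx0]
  have hW2 : 2 ≤ W := by exact_mod_cast hx2.trans hxW
  have hWd : W ≤ d := Nat.ceil_le.2 (by nlinarith [mul_nonneg hx0 (sub_nonneg.2 hx2)])
  have hW0 : (0 : ℝ) < W := by linarith
  have hupper : ∀ r ∈ Complex.im '' {z : ℂ | Lpoly d z = 0}, r ≤ d - 1 / 8 * x := by
    rintro _ ⟨z, hz, rfl⟩
    refine im_le_of_Lpoly_eq_zero (by omega) hWd (by linarith) ?_ hz
    have : (W : ℝ) ^ 2 ≤ (2 * x) ^ 2 := by gcongr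
    nlinarith
  obtain ⟨z, hz, hzim⟩ := exists_im_ge_Lpoly_eq_zero hW2 hWd
  have hmem : z.im ∈ Complex.im '' {z : ℂ | Lpoly d z = 0} := ⟨z, hz, rfl⟩
  have h1 := csSup_le ⟨_, hmem⟩ hupper
  have h2 := le_csSup ⟨_, hupper⟩ hmem
  refine ⟨by linarith, ?_⟩
  have hcos : 1 - 5 / (W : ℝ) ^ 2 ≤ Real.cos (Real.pi / W) := by
    refine le_trans ?_ (Real.one_sub_sq_div_two_le_cos)
    rw [div_pow, div_div, mul_comm, ← div_div]
    gcongr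
    nlinarith [Real.pi_lt_d2, Real.pi_pos]
  have hdW : (0 : ℝ) ≤ d - W := sub_nonneg.2 (by exact_mod_cast hWd)
  have h3 := mul_le_mul_of_nonneg_left hcos hdW
  have h4 : (d : ℝ) * (5 / (W : ℝ) ^ 2) ≤ 5 * x := by
    rw [mul_div_assoc', div_le_iff₀ (by positivity), ← hx3]
    have : x ^ 2 ≤ (W : ℝ) ^ 2 := by gcongr
    nlinarith
  have h5 : 0 ≤ (W : ℝ) * (5 / (W : ℝ) ^ 2) := by positivity
  nlinarith
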